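/- Let ε ∈ (0,1], δ ∈ (0,1), r ≥ 1, and let Sym_r denote the space of r×r real symmetric matrices with inner product ⟨X,Y⟩ = Tr(XY), so dim Sym_r = k = r(r+1)/2. Let φ : Sym_r → ℝ^k be a linear isomorphism preserving this inner product. Let 𝒟 be a type of databases with an adjacency relation, and let f : 𝒟 → Sym_r satisfy max_i |λ_i(f(D) − f(D'))| ≤ Δ_∞ for all adjacent D, D' (spectral-norm sensitivity Δ_∞ > 0). Set σ = √r·Δ_∞·√(2·ln(1.25/δ))/ε and let M(D) be the law of f(D) + φ⁻¹(ν) with ν ∼ N(0, σ²·I_k). Then for all adjacent D, D' and all Borel sets S ⊆ Sym_r, Pr[M(D) ∈ S] ≤ e^ε · Pr[M(D') ∈ S] + δ. -/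

import Mathlib

open MeasureTheory ProbabilityTheory RealInnerProductSpace

noncomputable instance matrixMeasurableSpace (r : ℕ) :
    MeasurableSpace (Matrix (Fin r) (Fin r) ℝ) :=
  inferInstanceAs (MeasurableSpace (Fin r → Fin r → ℝ))

/-- The space `Sym_r` of `r × r` real symmetric matrices, as a submodule of the matrix space. -/
def symMatrix (r : ℕ) : Submodule ℝ (Matrix (Fin r) (Fin r) ℝ) where
  carrier := {A | A.IsSymm}
  add_mem' := fun hA hB => hA.add hB
  zero_mem' := Matrix.isSymm_zero
  smul_mem' := fun c _ hA => hA.smul c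


lemma gm_density (u : ℝ) {s : NNReal} (hs : s ≠ 0) :
    gaussianReal u s = (gaussianReal 0 s).withDensity
      (fun x => ENNReal.ofReal (Real.exp ((2 * x * u - u ^ 2) / (2 * s)))) := by
  rw [gaussianReal_of_var_ne_zero u hs, gaussianReal_of_var_ne_zero 0 hs,
    ← withDensity_mul _ (measurable_gaussianPDF _ _) (by fun_prop)]
  congr 1
  ext x
  have hs' : (s : ℝ) ≠ 0 := by exact_mod_cast hs
  simp only [gaussianPDF, Pi.mul_apply, gaussianPDFReal]
  rw [← ENNReal.ofReal_mul (by positivity), mul_assoc _ (Real.exp _), ← Real.exp_add]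
  congr 3
  field_simp
  ring

lemma gm_density_pi {k : ℕ} (u : Fin k → ℝ) {s : NNReal} (hs : s ≠ 0) :
    Measure.pi (fun i => gaussianReal (u i) s) =
      (Measure.pi (fun _ : Fin k => gaussianReal 0 s)).withDensity
      (fun x => ENNReal.ofReal (Real.exp (∑ i, (2 * x i * u i - u i ^ 2) / (2 * s)))) := by
  apply Measure.pi_eq
  intro S hS
  rw [withDensity_apply _ (MeasurableSet.univ_pi hS), ← lintegral_indicator (MeasurableSet.univ_pi hS)]
  have h1 : ∀ i, gaussianReal (u i) s (S i) = ∫⁻ x : Fin k → ℝ,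
      (S i).indicator (fun x => ENNReal.ofReal (Real.exp ((2 * x * u i - u i ^ 2) / (2 * s)))) (x i)
        ∂(Measure.pi (fun _ : Fin k => gaussianReal 0 s)) := by
    intro i
    rw [(measurePreserving_eval (fun _ : Fin k => gaussianReal 0 s) i).lintegral_comp
      (f := (S i).indicator (fun x => ENNReal.ofReal (Real.exp ((2 * x * u i - u i ^ 2) / (2 * s)))))
      ((by fun_prop : Measurable _).indicator (hS i)), lintegral_indicator (hS i),
      ← withDensity_apply _ (hS i), ← gm_density _ hs]
  simp_rw [h1]
  have hind := iIndepFun_pi (μ := fun _ : Fin k => gaussianReal 0 s)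
    (X := fun i => (S i).indicator
      (fun x => ENNReal.ofReal (Real.exp ((2 * x * u i - u i ^ 2) / (2 * s)))))
    (fun i => ((by fun_prop : Measurable _).indicator (hS i)).aemeasurable)
  rw [← lintegral_prod_eq_prod_lintegral_of_indepFun _ _ hind (fun i =>
    ((by fun_prop : Measurable _).indicator (hS i)).comp (measurable_pi_apply i))]
  · congr 1
    ext x
    by_cases hx : x ∈ Set.univ.pi S
    · rw [Set.indicator_of_mem hx, Real.exp_sum, ENNReal.ofReal_prod_of_nonneg (fun _ _ => by positivity)]
      refine Finset.prod_congr rfl fun i _ => ?_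
      rw [Set.indicator_of_mem (hx i trivial)]
    · rw [Set.indicator_of_notMem hx]
      simp only [Set.mem_pi, Set.mem_univ, true_implies, not_forall] at hx
      obtain ⟨i, hi⟩ := hx
      rw [eq_comm, Finset.prod_eq_zero (Finset.mem_univ i)]
      rw [Set.indicator_of_notMem hi]

lemma gm_law {k : ℕ} (u : Fin k → ℝ) (s : NNReal) (n : ℝ) (hn : n ^ 2 = ∑ i, u i ^ 2) (σ : ℝ)
    (hσ : (s : ℝ) = σ ^ 2) :
    (Measure.pi (fun _ : Fin k => gaussianReal 0 s)).map (fun x => ∑ i, u i * x i) =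
      (gaussianReal 0 1).map (fun z => σ * n * z) := by
  rw [show (fun z => σ * n * z) = ((σ * n) * ·) from rfl, gaussianReal_map_const_mul]
  apply Measure.ext_of_charFun
  ext t
  have h2 := charFun_pi (μ := fun _ : Fin k => gaussianReal 0 s) (WithLp.toLp 2 (fun i => t * u i))
  rw [charFun_apply, integral_map (by fun_prop) (by fun_prop)] at h2
  rw [charFun_apply, integral_map
    (by fun_prop : Measurable fun x : Fin k → ℝ => ∑ i, u i * x i).aemeasurable (by fun_prop)]
  have h3 : ∀ x : Fin k → ℝ, inner ℝ (WithLp.toLp 2 x) (WithLp.toLp 2 (fun i => t * u i))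
     = inner ℝ (∑ i, u i * x i) t := by
    intro x
    simp [PiLp.inner_apply, Finset.mul_sum]
    refine Finset.sum_congr rfl fun i _ => by ring
  simp_rw [h3] at h2
  rw [h2]
  simp_rw [charFun_gaussianReal, ← Complex.exp_sum]
  congr 1
  have hn' : (n : ℂ) ^ 2 = ∑ i, (u i : ℂ) ^ 2 := by exact_mod_cast hn
  have hσ' : ((s : ℝ) : ℂ) = (σ : ℂ) ^ 2 := by exact_mod_cast hσ
  simp [mul_pow, hn', hσ', Finset.sum_div, Finset.mul_sum, Finset.sum_mul]
  refine Finset.sum_congr rfl fun i _ => by ring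

lemma gm_half : gaussianReal 0 1 (Set.Ioi 0) ≤ ENNReal.ofReal (1/2) := by
  have h : gaussianReal 0 1 (Set.Iio 0) = gaussianReal 0 1 (Set.Ioi 0) := by
    have := gaussianReal_map_neg (μ := 0) (v := 1)
    rw [neg_zero] at this
    conv_rhs => rw [← this]
    rw [Measure.map_apply (by fun_prop) measurableSet_Ioi]
    congr 1
    ext x
    simp
  have h2 : gaussianReal 0 1 (Set.Iio 0) + gaussianReal 0 1 (Set.Ioi 0) ≤ 1 := by
    rw [← measure_union (by
      rw [Set.disjoint_left]; intro x; simp; intro h; exact h.le) measurableSet_Ioi]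
    exact prob_le_one
  rw [h] at h2
  have hf : gaussianReal 0 1 (Set.Ioi 0) ≠ ⊤ := measure_ne_top _ _
  lift gaussianReal 0 1 (Set.Ioi 0) to NNReal using hf with p
  have h3 : (p : ℝ) + p ≤ 1 := by exact_mod_cast h2
  rw [← ENNReal.ofReal_coe_nnreal]
  exact ENNReal.ofReal_le_ofReal (by linarith)

lemma gm_tail_nonneg (t : ℝ) (ht : 0 ≤ t) :
    gaussianReal 0 1 (Set.Ioi t) ≤ ENNReal.ofReal (1 / 2 * Real.exp (-t ^ 2 / 2)) := by
  have h : gaussianReal 0 1 (Set.Ioi t) = gaussianReal (-t) 1 (Set.Ioi 0) := by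
    have := gaussianReal_map_add_const (μ := 0) (v := 1) (-t)
    rw [zero_add] at this
    rw [← this, Measure.map_apply (by fun_prop) measurableSet_Ioi]
    congr 1
    ext x
    simp
  rw [h, gm_density (-t) one_ne_zero, withDensity_apply _ measurableSet_Ioi]
  calc _ ≤ ∫⁻ x in Set.Ioi (0:ℝ), ENNReal.ofReal (Real.exp (-t ^ 2 / 2)) ∂(gaussianReal 0 1) := by
        refine setLIntegral_mono measurable_const fun x hx => ?_
        refine ENNReal.ofReal_le_ofReal (Real.exp_le_exp.2 ?_)
        have : 0 ≤ x * t := mul_nonneg (le_of_lt hx) ht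
        simp only [NNReal.coe_one]
        linarith
    _ = ENNReal.ofReal (Real.exp (-t ^ 2 / 2)) * gaussianReal 0 1 (Set.Ioi 0) := by simp
    _ ≤ ENNReal.ofReal (Real.exp (-t ^ 2 / 2)) * ENNReal.ofReal (1/2) := by
        gcongr; exact gm_half
    _ = _ := by rw [← ENNReal.ofReal_mul (by positivity), mul_comm]

lemma gm_tail_neg (t : ℝ) (ht : t ≤ 0) :
    gaussianReal 0 1 (Set.Ioi t) ≤ ENNReal.ofReal (1 / 2 - t) := by
  rw [← Set.Ioc_union_Ioi_eq_Ioi ht]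
  refine (measure_union_le _ _).trans ?_
  rw [sub_eq_neg_add, ENNReal.ofReal_add (by linarith) (by norm_num)]
  refine add_le_add ?_ gm_half
  rw [gaussianReal_apply _ one_ne_zero]
  calc _ ≤ ∫⁻ x in Set.Ioc t 0, 1 := by
        refine lintegral_mono fun x => ?_
        rw [gaussianPDF, ENNReal.ofReal_le_one, gaussianPDFReal]
        have h1 : Real.exp (-(x - 0) ^ 2 / (2 * (1 : NNReal))) ≤ 1 := by
          apply Real.exp_le_one_iff.2
          simp only [NNReal.coe_one]
          nlinarith [sq_nonneg (x - 0)]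
        have h2 : (√(2 * Real.pi * (1 : NNReal)))⁻¹ ≤ 1 := by
          apply inv_le_one_of_one_le₀
          rw [Real.one_le_sqrt]
          simp only [NNReal.coe_one]
          nlinarith [Real.pi_gt_three]
        exact mul_le_one₀ h2 (by positivity) h1
    _ = _ := by simp

lemma gm_tail (c ε δ : ℝ) (hc : 0 < c) (hε : 0 < ε) (hε1 : ε ≤ 1) (hδ : 0 < δ) (hδ1 : δ < 1)
    (hcd : c ^ 2 = 2 * Real.log (1.25 / δ)) :
    gaussianReal 0 1 (Set.Ioi (c - ε / (2 * c))) ≤ ENNReal.ofReal δ := by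
  have hd : δ = 1.25 * Real.exp (- c ^ 2 / 2) := by
    rw [hcd, show -(2 * Real.log (1.25 / δ)) / 2 = - Real.log (1.25 / δ) by ring, Real.exp_neg,
      Real.exp_log (by positivity)]
    field_simp
  have hε2 : ε / (2 * c) * c = ε / 2 := by field_simp
  set q := ε / (2 * c) with hq
  have hq0 : 0 < q := by positivity
  rcases le_total 0 (c - q) with ht | ht
  · refine (gm_tail_nonneg _ ht).trans (ENNReal.ofReal_le_ofReal ?_)
    have h1 : Real.exp (-(c - q) ^ 2 / 2) ≤ Real.exp (1 / 2) * Real.exp (- c ^ 2 / 2) := by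
      rw [← Real.exp_add]
      apply Real.exp_le_exp.2
      nlinarith [sq_nonneg q]
    have h2 : Real.exp (1 / 2) ≤ 2 := by
      have h3 : Real.exp (1/2) * Real.exp (1/2) = Real.exp 1 := by rw [← Real.exp_add]; norm_num
      nlinarith [Real.exp_one_lt_d9, Real.exp_pos (1/2)]
    rw [hd]
    nlinarith [Real.exp_pos (- c ^ 2 / 2)]
  · refine (gm_tail_neg _ ht).trans (ENNReal.ofReal_le_ofReal ?_)
    have hcc : c ^ 2 ≤ 1 / 2 := by nlinarith
    have hl : 0.4 ≤ c ^ 2 := by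
      have h1 := Real.one_sub_inv_le_log_of_pos (show 0 < 1.25 / δ by positivity)
      have h2 : (1.25 / δ)⁻¹ = δ * 0.8 := by field_simp; norm_num
      rw [h2] at h1
      nlinarith
    have h1 := Real.add_one_le_exp (- c ^ 2 / 2)
    have hc6 : 0.6 ≤ c := by nlinarith
    have hq1 : q ≤ 1 := by nlinarith
    have : q - c ≤ 0.4 := by linarith
    rw [hd]
    nlinarith

lemma gm_pi {k : ℕ} (u : Fin k → ℝ) {s : NNReal} (hs : s ≠ 0) (n Δ σ c ε δ : ℝ)
    (hn0 : 0 ≤ n) (hn : n ^ 2 = ∑ i, u i ^ 2) (hnΔ : n ≤ Δ) (hΔ : 0 < Δ)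
    (hσ : (s : ℝ) = σ ^ 2) (hσc : σ = Δ * c / ε)
    (hc : 0 < c) (hε : 0 < ε) (hε1 : ε ≤ 1) (hδ : 0 < δ) (hδ1 : δ < 1)
    (hcd : c ^ 2 = 2 * Real.log (1.25 / δ)) (T : Set (Fin k → ℝ)) (hT : MeasurableSet T) :
    (Measure.pi (fun _ : Fin k => gaussianReal 0 s)).map (fun x => x + u) T ≤
      ENNReal.ofReal (Real.exp ε) * (Measure.pi (fun _ : Fin k => gaussianReal 0 s)) T
        + ENNReal.ofReal δ := by
  have hσ0 : 0 < σ := by rw [hσc]; positivity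
  have hmap : (Measure.pi (fun _ : Fin k => gaussianReal 0 s)).map (fun x => x + u) =
      Measure.pi (fun i => gaussianReal (u i) s) := by
    have := Measure.pi_map_pi (μ := fun _ : Fin k => gaussianReal 0 s) (f := fun i x => x + u i)
      (fun i => by fun_prop)
    rw [show (fun x : Fin k → ℝ => x + u) = fun x i => x i + u i from rfl, this]
    congr 1
    ext1 i
    rw [gaussianReal_map_add_const, zero_add]
  set P := Measure.pi (fun _ : Fin k => gaussianReal 0 s) with hP
  set L : (Fin k → ℝ) → ℝ := fun x => ∑ i, (2 * x i * u i - u i ^ 2) / (2 * s) with hL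
  have hLm : Measurable L := by fun_prop
  set G := {x | L x ≤ ε} with hG
  have hGm : MeasurableSet G := measurableSet_le hLm measurable_const
  have h1 : P.map (fun x => x + u) (T ∩ G) ≤ ENNReal.ofReal (Real.exp ε) * P T := by
    rw [hmap, gm_density_pi u hs, withDensity_apply _ (hT.inter hGm)]
    calc _ ≤ ∫⁻ x in T ∩ G, ENNReal.ofReal (Real.exp ε) ∂P := by
          refine setLIntegral_mono measurable_const fun x hx => ?_
          exact ENNReal.ofReal_le_ofReal (Real.exp_le_exp.2 hx.2)
      _ = ENNReal.ofReal (Real.exp ε) * P (T ∩ G) := by simp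
      _ ≤ _ := by gcongr; exact Set.inter_subset_left
  have h2 : P.map (fun x => x + u) Gᶜ ≤ ENNReal.ofReal δ := by
    rw [Measure.map_apply (by fun_prop) hGm.compl]
    have hsub : (fun x => x + u) ⁻¹' Gᶜ ⊆
        (fun x : Fin k → ℝ => ∑ i, u i * x i) ⁻¹' Set.Ioi (σ ^ 2 * ε - n ^ 2 / 2) := by
      intro x hx
      simp only [hG, hL, Set.mem_preimage, Set.mem_compl_iff, Set.mem_ofPred_eq, not_le, Pi.add_apply,
        Set.mem_Ioi] at hx ⊢
      rw [← Finset.sum_div, hσ, lt_div_iff₀ (by positivity)] at hx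
      have : ∑ i, (2 * (x i + u i) * u i - u i ^ 2) = 2 * ∑ i, u i * x i + n ^ 2 := by
        rw [hn, Finset.mul_sum, ← Finset.sum_add_distrib]
        exact Finset.sum_congr rfl fun i _ => by ring
      rw [this] at hx
      linarith
    refine (measure_mono hsub).trans ?_
    rw [← Measure.map_apply (by fun_prop) measurableSet_Ioi, gm_law u s n hn σ hσ,
      Measure.map_apply (by fun_prop) measurableSet_Ioi]
    refine (measure_mono ?_).trans (gm_tail c ε δ hc hε hε1 hδ hδ1 hcd)
    intro z hz
    simp only [Set.mem_preimage, Set.mem_Ioi] at hz ⊢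
    have hnp : 0 < n := by
      rcases hn0.lt_or_eq with h | h
      · exact h
      · rw [← h] at hz
        have : 0 < σ ^ 2 * ε := by positivity
        simp at hz
        linarith
    have hz2 : σ * ε / n - n / (2 * σ) < z := by
      have e : σ * ε / n - n / (2 * σ) = (σ ^ 2 * ε - n ^ 2 / 2) / (σ * n) := by field_simp
      rw [e, div_lt_iff₀ (by positivity)]
      linarith
    have e1 : c = σ * ε / Δ := by rw [hσc]; field_simp
    have e2 : ε / (2 * c) = Δ / (2 * σ) := by rw [hσc]; field_simp
    rw [e2]
    have e3 : c ≤ σ * ε / n := by rw [e1]; gcongr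
    have e4 : n / (2 * σ) ≤ Δ / (2 * σ) := by gcongr
    linarith
  calc _ ≤ P.map (fun x => x + u) (T ∩ G ∪ Gᶜ) := by
        apply measure_mono
        intro x hx
        by_cases h : x ∈ G
        · exact Or.inl ⟨hx, h⟩
        · exact Or.inr h
    _ ≤ _ := (measure_union_le _ _).trans (add_le_add h1 h2)

lemma gm_trace {r : ℕ} (A : Matrix (Fin r) (Fin r) ℝ) (h : A.IsHermitian) (B : ℝ)
    (hB : ∀ i, |h.eigenvalues i| ≤ B) : (A * A).trace ≤ r * B ^ 2 := by
  have e : (A * A).trace = ∑ i, h.eigenvalues i ^ 2 := by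
    conv_lhs => rw [h.spectral_theorem]
    rw [← map_mul, Matrix.diagonal_mul_diagonal, Unitary.conjStarAlgAut_apply, Matrix.trace_mul_cycle]
    simp [Matrix.trace_diagonal, pow_two]
  rw [e]
  calc _ ≤ ∑ i : Fin r, B ^ 2 := Finset.sum_le_sum fun i _ => sq_le_sq.2 ((hB i).trans (le_abs_self _))
    _ = _ := by simp


/-- The generic Gaussian mechanism on the space of `r × r` real symmetric
matrices with spectral-norm (`ℓ_∞`, i.e. max absolute eigenvalue) sensitivity `Δ_∞`,
using noise scale `σ = √r · Δ_∞ · √(2 ln(1.25/δ)) / ε`, is `(ε, δ)`-differentially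
private. -/
theorem gaussian_mechanism_symmetric_matrices_spectral_sensitivity
    {r : ℕ} (hr : 1 ≤ r) {k : ℕ} (hk : k = r * (r + 1) / 2)
    (ε δ : ℝ) (hε : 0 < ε) (hε1 : ε ≤ 1) (hδ : 0 < δ) (hδ1 : δ < 1)
    (φ : symMatrix r ≃ₗ[ℝ] EuclideanSpace ℝ (Fin k))
    (hφ : ∀ X Y : symMatrix r,
      ⟪φ X, φ Y⟫ = ((X : Matrix (Fin r) (Fin r) ℝ) * (Y : Matrix (Fin r) (Fin r) ℝ)).trace)
    {𝒟 : Type*} (adj : 𝒟 → 𝒟 → Prop)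
    (f : 𝒟 → symMatrix r) (Δinf : ℝ) (hΔinf : 0 < Δinf)
    (hsens : ∀ D D', adj D D' →
      ∀ h : ((f D : Matrix (Fin r) (Fin r) ℝ) - (f D' : Matrix (Fin r) (Fin r) ℝ)).IsHermitian,
        ∀ i, |h.eigenvalues i| ≤ Δinf)
    (σ : ℝ) (hσ : σ = Real.sqrt r * Δinf * Real.sqrt (2 * Real.log (1.25 / δ)) / ε)
    (ν : Measure (EuclideanSpace ℝ (Fin k)))
    (hν : ν = Measure.map (⇑(EuclideanSpace.equiv (Fin k) ℝ).symm)
        (Measure.pi fun _ : Fin k => gaussianReal 0 (Real.toNNReal (σ ^ 2))))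
    (M : 𝒟 → Measure (symMatrix r))
    (hM : ∀ D, M D = Measure.map (fun w => f D + φ.symm w) ν) :
    ∀ D D', adj D D' → ∀ S : Set (symMatrix r), MeasurableSet S →
      M D S ≤ ENNReal.ofReal (Real.exp ε) * M D' S + ENNReal.ofReal δ := by
  intro D D' hadj S hS
  have hlog : 0 < Real.log (1.25 / δ) := by
    apply Real.log_pos
    rw [lt_div_iff₀ hδ]
    linarith
  have hc : 0 < Real.sqrt (2 * Real.log (1.25 / δ)) := Real.sqrt_pos.2 (by positivity)
  have hr' : (0 : ℝ) < r := by exact_mod_cast hr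
  have hΔ : 0 < Real.sqrt r * Δinf := mul_pos (Real.sqrt_pos.2 hr') hΔinf
  have hσ0 : 0 < σ := by rw [hσ]; positivity
  have hs : Real.toNNReal (σ ^ 2) ≠ 0 := by
    rw [Ne, Real.toNNReal_eq_zero, not_le]; positivity
  have hs2 : ((Real.toNNReal (σ ^ 2) : NNReal) : ℝ) = σ ^ 2 := Real.coe_toNNReal _ (sq_nonneg _)
  set v : EuclideanSpace ℝ (Fin k) := φ (f D - f D') with hv
  have hherm : ((f D : Matrix (Fin r) (Fin r) ℝ) - (f D' : Matrix (Fin r) (Fin r) ℝ)).IsHermitian := by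
    have h := (f D - f D').2
    rw [Matrix.IsHermitian, Matrix.conjTranspose_eq_transpose_of_trivial]
    exact h
  have hvn : ‖v‖ ≤ Real.sqrt r * Δinf := by
    have h1 : ‖v‖ ^ 2 ≤ r * Δinf ^ 2 := by
      rw [← real_inner_self_eq_norm_sq, hv, hφ]
      exact gm_trace _ hherm Δinf (hsens D D' hadj hherm)
    apply le_of_sq_le_sq _ hΔ.le
    rw [mul_pow, Real.sq_sqrt hr'.le]
    exact h1
  have hψ : ∀ E : 𝒟, Measurable (fun w : Fin k → ℝ => f E + φ.symm (WithLp.toLp 2 w)) := by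
    intro E
    refine Measurable.subtype_mk (f := fun w : Fin k → ℝ =>
      ((f E + φ.symm (WithLp.toLp 2 w) : symMatrix r) : Matrix (Fin r) (Fin r) ℝ)) ?_
    refine measurable_pi_iff.2 fun i => measurable_pi_iff.2 fun j => ?_
    let l : (Fin k → ℝ) →ₗ[ℝ] ℝ :=
      (Matrix.entryLinearMap ℝ ℝ i j) ∘ₗ (symMatrix r).subtype ∘ₗ φ.symm.toLinearMap ∘ₗ
        (WithLp.linearEquiv 2 ℝ (Fin k → ℝ)).symm.toLinearMap
    have hl : Measurable l := (LinearMap.continuous_of_finiteDimensional l).measurable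
    exact measurable_const.add hl
  have hM' : ∀ E, M E = (Measure.pi fun _ : Fin k => gaussianReal 0 (Real.toNNReal (σ ^ 2))).map
      (fun w => f E + φ.symm (WithLp.toLp 2 w)) := by
    intro E
    have hm : Measurable (fun w => f E + φ.symm w) :=
      (hψ E).comp (WithLp.measurable_ofLp 2 (Fin k → ℝ))
    rw [hM, hν, Measure.map_map hm (by fun_prop)]
    rfl
  rw [hM', hM', Measure.map_apply (hψ D) hS, Measure.map_apply (hψ D') hS]
  have key := gm_pi (WithLp.ofLp v) hs ‖v‖ (Real.sqrt r * Δinf) σ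
    (Real.sqrt (2 * Real.log (1.25 / δ))) ε δ (norm_nonneg _)
    (EuclideanSpace.real_norm_sq_eq v) hvn hΔ hs2 hσ hc hε hε1 hδ hδ1
    (Real.sq_sqrt (by positivity)) _ (hψ D' hS)
  rw [Measure.map_apply (by fun_prop) (hψ D' hS)] at key
  convert key using 2
  ext x
  simp only [Set.mem_preimage]
  have : f D' + φ.symm (WithLp.toLp 2 (x + WithLp.ofLp v)) = f D + φ.symm (WithLp.toLp 2 x) := by
    rw [WithLp.toLp_add, map_add, WithLp.toLp_ofLp, hv, LinearEquiv.symm_apply_apply]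
    abel
  rw [this]
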